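/- Let T : X → X be an operator and let F be a full Furstenberg family. Then the following are equivalent: (1) T is (F̃)*-transitive; (2) T is weakly disjoint from every F-mixing operator S : Y → Y, where Y ranges over infinite-dimensional separable Fréchet spaces; (3) T is weakly disjoint from every invertible F-mixing bilateral weighted backward shift on Y, where Y = c₀(ℤ) or ℓ^p(ℤ), 1 ≤ p < ∞. -/

import Mathlib

open Set Topology Function Filter
open scoped ENNReal

/- ### Basic dynamical notions -/

/-- The return time set `N(U,V) = {n ∈ ℕ : T^n(U) ∩ V ≠ ∅}`. -/
def nset {X : Type*} (T : X → X) (U V : Set X) : Set ℕ :=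
  {n : ℕ | ∃ x ∈ U, T^[n] x ∈ V}

/-- A Furstenberg family: nonempty, hereditary upward, not containing `∅`. -/
def IsFamily (F : Set (Set ℕ)) : Prop :=
  F.Nonempty ∧ (∀ ⦃A B : Set ℕ⦄, A ∈ F → A ⊆ B → B ∈ F) ∧ ∅ ∉ F

/-- `T` is `F`-transitive. -/
def FTrans {X : Type*} [TopologicalSpace X] (T : X → X) (F : Set (Set ℕ)) : Prop :=
  ∀ U V : Set X, IsOpen U → IsOpen V → U.Nonempty → V.Nonempty → nset T U V ∈ F

/-- Direct sum (product) of two maps. -/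
def prodMap' {X Y : Type*} (T : X → X) (S : Y → Y) : X × Y → X × Y :=
  fun p => (T p.1, S p.2)

/-- `T` is `F`-mixing: `T × T` is `F`-transitive. -/
def FMix {X : Type*} [TopologicalSpace X] (T : X → X) (F : Set (Set ℕ)) : Prop :=
  FTrans (prodMap' T T) F

/-- Topological transitivity. -/
def TopTrans {X : Type*} [TopologicalSpace X] (T : X → X) : Prop :=
  ∀ U V : Set X, IsOpen U → IsOpen V → U.Nonempty → V.Nonempty → (nset T U V).Nonempty

/-- Weak mixing: `T × T` is topologically transitive. -/
def WMix {X : Type*} [TopologicalSpace X] (T : X → X) : Prop :=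
  TopTrans (prodMap' T T)

/-- Hypercyclicity: some point has dense orbit. -/
def HypercyclicMap {X : Type*} [TopologicalSpace X] (T : X → X) : Prop :=
  ∃ x : X, Dense (Set.range fun n : ℕ => T^[n] x)

/-- Weak disjointness: the direct sum is hypercyclic. -/
def WeaklyDisjoint {X Y : Type*} [TopologicalSpace X] [TopologicalSpace Y]
    (T : X → X) (S : Y → Y) : Prop :=
  HypercyclicMap (prodMap' T S)

/-- The family generated by the return time sets of `T`. -/
def NTfam {X : Type*} [TopologicalSpace X] (T : X → X) : Set (Set ℕ) :=
  {A : Set ℕ | ∃ U V : Set X, IsOpen U ∧ IsOpen V ∧ U.Nonempty ∧ V.Nonempty ∧ nset T U V ⊆ A}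

/- ### Combinatorial families -/

/-- `(A + i) ∩ ℕ` for `i : ℤ`. -/
def shiftSet (A : Set ℕ) (i : ℤ) : Set ℕ := {n : ℕ | ∃ m ∈ A, (n : ℤ) = (m : ℤ) + i}

/-- A shift-invariant family. -/
def ShiftInvariant (F : Set (Set ℕ)) : Prop := ∀ A ∈ F, ∀ i : ℤ, shiftSet A i ∈ F

/-- A shift₊-invariant family: `A + i ∈ F` for `i : ℕ`. -/
def ShiftPlusInvariant (F : Set (Set ℕ)) : Prop :=
  ∀ A ∈ F, ∀ i : ℕ, (fun n => n + i) '' A ∈ F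

/-- A thick family: `⋂_{i=0}^{k} ((A - i) ∩ ℕ) ∈ F` for all `A ∈ F`, `k ∈ ℕ`. -/
def ThickFamily (F : Set (Set ℕ)) : Prop :=
  ∀ A ∈ F, ∀ k : ℕ, {n : ℕ | ∀ i ≤ k, n + i ∈ A} ∈ F

/-- The dual family `F*`. -/
def dualFam (F : Set (Set ℕ)) : Set (Set ℕ) := {A | ∀ B ∈ F, (A ∩ B).Nonempty}

/-- A full family. -/
def FullFamily (F : Set (Set ℕ)) : Prop :=
  ∀ A ∈ F, ∀ B ∈ dualFam F, (A ∩ B).Infinite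

/-- `F̃`: the members `A` of `F` with `⋂_{i=-k}^{k} ((A + i) ∩ ℕ) ∈ F` for all `k ∈ ℕ`. -/
def tildeFam (F : Set (Set ℕ)) : Set (Set ℕ) :=
  {A ∈ F | ∀ k : ℕ, {n : ℕ | ∀ i : ℤ, |i| ≤ (k : ℤ) → n ∈ shiftSet A i} ∈ F}

/-- A thick subset of `ℕ`: contains arbitrarily long blocks of consecutive integers. -/
def IsThickSet (A : Set ℕ) : Prop := ∀ k : ℕ, ∃ n : ℕ, ∀ i ≤ k, n + i ∈ A

/-- A syndetic subset of `ℕ` (bounded gaps). -/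
def IsSyndetic (A : Set ℕ) : Prop := ∃ g : ℕ, ∀ n : ℕ, ∃ m ∈ A, n ≤ m ∧ m ≤ n + g

/-- A piecewise syndetic subset: intersection of a syndetic and a thick set. -/
def IsPiecewiseSyndetic (A : Set ℕ) : Prop :=
  ∃ S T : Set ℕ, IsSyndetic S ∧ IsThickSet T ∧ A = S ∩ T

/-- An IP-set. -/
def IsIPSet (A : Set ℕ) : Prop :=
  ∃ x : ℕ → ℕ, {n | x n ≠ 0}.Infinite ∧ ∀ s : Finset ℕ, s.Nonempty → (∑ i ∈ s, x i) ∈ A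

/-- `(A - A) ∩ ℕ` for `A ⊆ ℕ`: positive differences of distinct elements. -/
def diffSet (A : Set ℕ) : Set ℕ := {k | ∃ m ∈ A, ∃ n ∈ A, n < m ∧ k = m - n}

/-- The family `Δ*_ip`. -/
def deltaIPStar : Set (Set ℕ) :=
  {A | ∀ F : Set ℕ, IsIPSet F → (A ∩ diffSet F).Nonempty}

/- ### Operators on Fréchet spaces -/

/-- A (continuous linear) operator on an infinite-dimensional separable Fréchet space
(a complete metrizable locally convex topological vector space) over `ℝ` or `ℂ`
(an `RCLike` field). -/
structure FrechetOp where
  𝕜 : Type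
  [instField : RCLike 𝕜]
  X : Type
  [instAdd : AddCommGroup X]
  [instMod : Module 𝕜 X]
  [instUnif : UniformSpace X]
  [instUAG : IsUniformAddGroup X]
  [instSMul : ContinuousSMul 𝕜 X]
  [instComplete : CompleteSpace X]
  [instMetrizable : TopologicalSpace.MetrizableSpace X]
  [instSeparable : TopologicalSpace.SeparableSpace X]
  [instModR : Module ℝ X]
  [instTower : IsScalarTower ℝ 𝕜 X]
  [instLC : LocallyConvexSpace ℝ X]
  infDim : ¬ FiniteDimensional 𝕜 X
  T : X → X
  linear : IsLinearMap 𝕜 T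
  cont : Continuous T

attribute [instance] FrechetOp.instAdd FrechetOp.instMod
  FrechetOp.instUnif FrechetOp.instUAG FrechetOp.instSMul FrechetOp.instComplete
  FrechetOp.instMetrizable FrechetOp.instSeparable FrechetOp.instModR
  FrechetOp.instTower FrechetOp.instLC

/-- A bundled Fréchet-space operator is hypercyclic. -/
def FrechetOp.Hypercyclic (S : FrechetOp) : Prop := HypercyclicMap S.T

/-- A bundled Fréchet-space operator is invertible (a linear homeomorphism). -/
def FrechetOp.Invertible (S : FrechetOp) : Prop :=
  ∃ T' : S.X → S.X, Continuous T' ∧ (∀ x, T' (S.T x) = x) ∧ (∀ x, S.T (T' x) = x)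

/-- Mild mixing: weakly disjoint from every hypercyclic operator
(on every infinite-dimensional separable Fréchet space). -/
def MildlyMixing {X : Type*} [TopologicalSpace X] (T : X → X) : Prop :=
  ∀ S : FrechetOp, S.Hypercyclic → WeaklyDisjoint T S.T

/-- Topological ergodicity: all return time sets are syndetic. -/
def TopErgodic {X : Type*} [TopologicalSpace X] (T : X → X) : Prop :=
  ∀ U V : Set X, IsOpen U → IsOpen V → U.Nonempty → V.Nonempty → IsSyndetic (nset T U V)

/-- The `F`-Mixing Criterion for a map `T`. -/
def FMixCriterion {X : Type*} [TopologicalSpace X] [Zero X] (T : X → X)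
    (F : Set (Set ℕ)) : Prop :=
  ∃ X₀ Y₀ : Set X, Dense X₀ ∧ Dense Y₀ ∧ ∃ S : ℕ → X → X,
    ∀ x₀ ∈ X₀, ∀ y₀ ∈ Y₀, ∀ O ∈ nhds ((0, 0, y₀) : X × X × X),
      {n : ℕ | (T^[n] x₀, S n y₀, T^[n] (S n y₀)) ∈ O} ∈ F

/- ### Bilateral weighted backward shifts on `ℓᵖ(ℤ)` and `c₀(ℤ)` -/

/-- `B` is the bilateral weighted backward shift with (positive, bounded) weight `w` on
`ℓᵖ(ℤ)`; the condition that `1/w` is bounded makes it invertible. -/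
def IsInvertibleWBSlp (𝕜 : Type) [RCLike 𝕜] (p : ℝ≥0∞) [Fact (1 ≤ p)] (w : ℤ → ℝ)
    (B : lp (fun _ : ℤ => 𝕜) p →L[𝕜] lp (fun _ : ℤ => 𝕜) p) : Prop :=
  (∀ n, 0 < w n) ∧ (∃ C : ℝ, ∀ n, w n ≤ C) ∧ (∃ c : ℝ, 0 < c ∧ ∀ n, c ≤ w n) ∧
    ∀ (x : lp (fun _ : ℤ => 𝕜) p) (n : ℤ), B x n = w (n + 1) • x (n + 1)

/-- `B` is the bilateral weighted backward shift with (positive, bounded) weight `w` on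
`c₀(ℤ)`; the condition that `1/w` is bounded makes it invertible. -/
def IsInvertibleWBSc0 (𝕜 : Type) [RCLike 𝕜] (w : ℤ → ℝ)
    (B : ZeroAtInftyContinuousMap ℤ 𝕜 →L[𝕜] ZeroAtInftyContinuousMap ℤ 𝕜) : Prop :=
  (∀ n, 0 < w n) ∧ (∃ C : ℝ, ∀ n, w n ≤ C) ∧ (∃ c : ℝ, 0 < c ∧ ∀ n, c ≤ w n) ∧
    ∀ (x : ZeroAtInftyContinuousMap ℤ 𝕜) (n : ℤ), B x n = w (n + 1) • x (n + 1)

/- ### General dynamical lemmas -/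

lemma iterate_prodMap' {X Y : Type*} (T : X → X) (S : Y → Y) (n : ℕ) (p : X × Y) :
    (prodMap' T S)^[n] p = (T^[n] p.1, S^[n] p.2) := by
  induction n with
  | zero => rfl
  | succ n ih => rw [Function.iterate_succ_apply', Function.iterate_succ_apply',
      Function.iterate_succ_apply', ih]; rfl

lemma nset_prod {X Y : Type*} (T : X → X) (S : Y → Y) (U V : Set X) (U' V' : Set Y) :
    nset (prodMap' T S) (U ×ˢ U') (V ×ˢ V') = nset T U V ∩ nset S U' V' := by
  ext n
  simp only [nset, Set.mem_inter_iff, Set.mem_ofPred_eq, iterate_prodMap']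
  constructor
  · rintro ⟨⟨x, y⟩, ⟨h1, h2⟩, h3, h4⟩
    exact ⟨⟨x, h1, h3⟩, ⟨y, h2, h4⟩⟩
  · rintro ⟨⟨x, h1, h3⟩, ⟨y, h2, h4⟩⟩
    exact ⟨(x, y), ⟨h1, h2⟩, h3, h4⟩

lemma nset_mono {X : Type*} (T : X → X) {U V U' V' : Set X} (hU : U ⊆ U') (hV : V ⊆ V') :
    nset T U V ⊆ nset T U' V' := by
  rintro n ⟨x, hx, hy⟩
  exact ⟨x, hU hx, hV hy⟩

/-- Every nonempty open subset of a product contains a nonempty open box. -/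
lemma exists_box {X Y : Type*} [TopologicalSpace X] [TopologicalSpace Y] {U : Set (X × Y)}
    (hU : IsOpen U) (hne : U.Nonempty) :
    ∃ (A : Set X) (B : Set Y), IsOpen A ∧ IsOpen B ∧ A.Nonempty ∧ B.Nonempty ∧ A ×ˢ B ⊆ U := by
  obtain ⟨⟨x, y⟩, h⟩ := hne
  obtain ⟨A, B, hA, hB, hx, hy, hs⟩ := isOpen_prod_iff.1 hU x y h
  exact ⟨A, B, hA, hB, ⟨x, hx⟩, ⟨y, hy⟩, hs⟩

/-- Birkhoff's transitivity theorem. -/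
lemma hypercyclic_of_topTrans {Z : Type*} [TopologicalSpace Z] [SecondCountableTopology Z]
    [BaireSpace Z] [Nonempty Z] {f : Z → Z} (hf : Continuous f) (h : TopTrans f) :
    HypercyclicMap f := by
  have hb := TopologicalSpace.isBasis_countableBasis Z
  have key : Dense (⋂ V ∈ TopologicalSpace.countableBasis Z, ⋃ n : ℕ, f^[n] ⁻¹' V) := by
    refine dense_biInter_of_isOpen (fun V hV => ?_) (TopologicalSpace.countable_countableBasis Z)
      (fun V hV => ?_)
    · exact isOpen_iUnion fun n => (hb.isOpen hV).preimage (hf.iterate n)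
    · rw [dense_iff_inter_open]
      intro U hU hUne
      obtain ⟨n, x, hx, hy⟩ := h U V hU (hb.isOpen hV) hUne
        (TopologicalSpace.nonempty_of_mem_countableBasis hV)
      exact ⟨x, hx, Set.mem_iUnion.2 ⟨n, hy⟩⟩
  obtain ⟨x, hx⟩ := key.nonempty
  refine ⟨x, hb.dense_iff.2 fun V hV _ => ?_⟩
  obtain ⟨n, hn⟩ := Set.mem_iUnion.1 (Set.mem_iInter₂.1 hx V hV)
  exact ⟨f^[n] x, hn, n, rfl⟩

lemma topTrans_of_hypercyclic {Z : Type*} [TopologicalSpace Z] [T1Space Z]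
    [∀ x : Z, NeBot (𝓝[≠] x)] {f : Z → Z} (h : HypercyclicMap f) :
    TopTrans f := by
  classical
  obtain ⟨x, hx⟩ := h
  intro U V hU hV hUn hVn
  obtain ⟨_, hn, n, rfl⟩ := hx.inter_open_nonempty U hU hUn
  obtain ⟨_, hm, ⟨m, rfl⟩, hm'⟩ := (hx.sdiff_finset ((Finset.range n).image fun k => f^[k] x)
    ).inter_open_nonempty V hV hVn
  have hnm : n ≤ m := by
    by_contra hlt
    exact hm' (Finset.mem_coe.2 (Finset.mem_image.2 ⟨m, Finset.mem_range.2 (by omega), rfl⟩))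
  refine ⟨m - n, f^[n] x, hn, ?_⟩
  rw [← Function.iterate_add_apply, Nat.sub_add_cancel hnm]
  exact hm

/- ### Full families -/

lemma mem_of_dual {F : Set (Set ℕ)} (hF : IsFamily F) {A : Set ℕ}
    (h : ∀ B ∈ dualFam F, (A ∩ B).Nonempty) : A ∈ F := by
  by_contra hA
  have hc : Aᶜ ∈ dualFam F := by
    intro B hB
    by_contra hne
    refine hA (hF.2.1 hB fun x hx => ?_)
    by_contra hxA
    exact hne ⟨x, hxA, hx⟩
  obtain ⟨x, hx, hx'⟩ := h _ hc
  exact hx' hx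

lemma inter_Ici_mem {F : Set (Set ℕ)} (hF : IsFamily F) (hfull : FullFamily F) {A : Set ℕ}
    (hA : A ∈ F) (k : ℕ) : A ∩ {n | k ≤ n} ∈ F := by
  refine mem_of_dual hF fun B hB => ?_
  obtain ⟨n, hn, hkn⟩ := (hfull A hA B hB).exists_gt k
  exact ⟨n, ⟨hn.1, hkn.le⟩, hn.2⟩

lemma weakMix_inter {Y : Type*} [TopologicalSpace Y] {S : Y → Y} (hS : Continuous S)
    (hw : WMix S) {U₁ V₁ U₂ V₂ : Set Y} (hU₁ : IsOpen U₁) (hV₁ : IsOpen V₁) (hU₂ : IsOpen U₂)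
    (hV₂ : IsOpen V₂) (nU₁ : U₁.Nonempty) (nV₁ : V₁.Nonempty) (nU₂ : U₂.Nonempty)
    (nV₂ : V₂.Nonempty) :
    ∃ U V : Set Y, IsOpen U ∧ IsOpen V ∧ U.Nonempty ∧ V.Nonempty ∧
      nset S U V ⊆ nset S U₁ V₁ ∩ nset S U₂ V₂ := by
  have := hw (U₁ ×ˢ V₁) (U₂ ×ˢ V₂) (hU₁.prod hV₁) (hU₂.prod hV₂) (nU₁.prod nV₁) (nU₂.prod nV₂)
  rw [nset_prod] at this
  obtain ⟨n, ⟨x, hx, hx'⟩, ⟨y, hy, hy'⟩⟩ := this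
  refine ⟨U₁ ∩ S^[n] ⁻¹' U₂, V₁ ∩ S^[n] ⁻¹' V₂, hU₁.inter (hU₂.preimage (hS.iterate n)),
    hV₁.inter (hV₂.preimage (hS.iterate n)), ⟨x, hx, hx'⟩, ⟨y, hy, hy'⟩, ?_⟩
  rintro m ⟨z, ⟨hz1, hz2⟩, hz3, hz4⟩
  refine ⟨⟨z, hz1, hz3⟩, S^[n] z, hz2, ?_⟩
  rw [← Function.iterate_add_apply, add_comm, Function.iterate_add_apply]
  exact hz4

lemma weakMix_iInter {Y : Type*} [TopologicalSpace Y] [Nonempty Y] {S : Y → Y} (hS : Continuous S)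
    (hw : WMix S) {ι : Type*} (s : Finset ι) (U V : ι → Set Y)
    (h : ∀ i ∈ s, IsOpen (U i) ∧ IsOpen (V i) ∧ (U i).Nonempty ∧ (V i).Nonempty) :
    ∃ U' V' : Set Y, IsOpen U' ∧ IsOpen V' ∧ U'.Nonempty ∧ V'.Nonempty ∧
      ∀ i ∈ s, nset S U' V' ⊆ nset S (U i) (V i) := by
  classical
  induction s using Finset.induction_on with
  | empty => exact ⟨univ, univ, isOpen_univ, isOpen_univ, univ_nonempty, univ_nonempty, by simp⟩
  | insert a s ha ih =>
    obtain ⟨U', V', h1, h2, h3, h4, h5⟩ := ih fun i hi => h i (Finset.mem_insert_of_mem hi)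
    obtain ⟨g1, g2, g3, g4⟩ := h a (Finset.mem_insert_self _ _)
    obtain ⟨U'', V'', k1, k2, k3, k4, k5⟩ := weakMix_inter hS hw h1 h2 g1 g2 h3 h4 g3 g4
    refine ⟨U'', V'', k1, k2, k3, k4, fun i hi => ?_⟩
    rcases Finset.mem_insert.1 hi with rfl | hi
    · exact k5.trans inter_subset_right
    · exact (k5.trans inter_subset_left).trans (h5 i hi)

lemma FMix.fTrans {Y : Type*} [TopologicalSpace Y] {S : Y → Y} {F : Set (Set ℕ)}
    (h : FMix S F) : FTrans S F := by
  intro U V hU hV nU nV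
  have := h (U ×ˢ U) (V ×ˢ V) (hU.prod hU) (hV.prod hV) (nU.prod nU) (nV.prod nV)
  rw [nset_prod, inter_self] at this
  exact this

lemma nonempty_of_mem_fam {F : Set (Set ℕ)} (hF : IsFamily F) {A : Set ℕ} (hA : A ∈ F) :
    A.Nonempty := by
  rw [Set.nonempty_iff_ne_empty]
  rintro rfl
  exact hF.2.2 hA

lemma nset_mem_tildeFam {Y : Type*} [TopologicalSpace Y] {S : Y → Y}
    (hS : Continuous S) {F : Set (Set ℕ)} (hF : IsFamily F) (hfull : FullFamily F)
    (h : FMix S F) {U V : Set Y} (hU : IsOpen U) (hV : IsOpen V) (nU : U.Nonempty)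
    (nV : V.Nonempty) : nset S U V ∈ tildeFam F := by
  have hT := h.fTrans
  have : Nonempty Y := ⟨nU.some⟩
  have hw : WMix S := fun U V a b c d => nonempty_of_mem_fam hF (h U V a b c d)
  have hpre1 : ∀ W : Set Y, IsOpen W → W.Nonempty → (S ⁻¹' W).Nonempty := by
    intro W hW nW
    obtain ⟨n, ⟨x, hx, hx'⟩, hn⟩ := nonempty_of_mem_fam hF
      (inter_Ici_mem hF hfull (hT W W hW hW nW nW) 1)
    obtain ⟨m, rfl⟩ : ∃ m, n = m + 1 := ⟨n - 1, by simp at hn; omega⟩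
    rw [Function.iterate_succ_apply'] at hx'
    exact ⟨_, hx'⟩
  have hpre : ∀ (n : ℕ) (W : Set Y), IsOpen W → W.Nonempty → (S^[n] ⁻¹' W).Nonempty := by
    intro n
    induction n with
    | zero => intro W _ h; exact h
    | succ n ih =>
      intro W hW nW
      have := ih _ (hW.preimage hS) (hpre1 W hW nW)
      rw [Function.iterate_succ', Set.preimage_comp]
      exact this
  refine ⟨hT U V hU hV nU nV, fun k => ?_⟩
  obtain ⟨U', V', a1, a2, a3, a4, a5⟩ := weakMix_iInter hS hw (Finset.Icc (-(k : ℤ)) k)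
    (fun i => S^[i.toNat] ⁻¹' U) (fun i => S^[(-i).toNat] ⁻¹' V)
    (fun i _ => ⟨hU.preimage (hS.iterate _), hV.preimage (hS.iterate _), hpre _ U hU nU,
      hpre _ V hV nV⟩)
  refine hF.2.1 (inter_Ici_mem hF hfull (hT U' V' a1 a2 a3 a4) k) ?_
  rintro n ⟨hn, hkn⟩ i hi
  have hkn : k ≤ n := hkn
  rw [abs_le] at hi
  obtain ⟨x, hx, hx'⟩ := a5 i (Finset.mem_Icc.2 hi) hn
  refine ⟨((n : ℤ) - i).toNat, ⟨S^[i.toNat] x, hx, ?_⟩, by omega⟩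
  have hx'' : S^[(-i).toNat] (S^[n] x) ∈ V := hx'
  rw [← Function.iterate_add_apply] at hx'' ⊢
  convert hx'' using 2
  omega

lemma weaklyDisjoint_of_fTrans {X Y : Type*} [TopologicalSpace X] [TopologicalSpace Y]
    [Nonempty X] [Nonempty Y] [PolishSpace X] [PolishSpace Y] {T : X → X} {S : Y → Y}
    (hTc : Continuous T)
    (hS : Continuous S) {F : Set (Set ℕ)} (hF : IsFamily F) (hfull : FullFamily F)
    (hT : FTrans T (dualFam (tildeFam F))) (h : FMix S F) : WeaklyDisjoint T S := by
  refine hypercyclic_of_topTrans ?_ ?_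
  · exact (hTc.comp continuous_fst).prodMk (hS.comp continuous_snd)
  · intro U V hU hV nU nV
    obtain ⟨A, B, hA, hB, nA, nB, hs⟩ := exists_box hU nU
    obtain ⟨A', B', hA', hB', nA', nB', hs'⟩ := exists_box hV nV
    refine Set.Nonempty.mono (nset_mono _ hs hs') ?_
    rw [nset_prod]
    exact hT A A' hA hA' nA nA' _ (nset_mem_tildeFam hS hF hfull h hB hB' nB nB')

lemma FrechetOp.polish (T : FrechetOp) : PolishSpace T.X := by
  have : (uniformity T.X).IsCountablyGenerated := IsUniformAddGroup.uniformity_countably_generated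
  infer_instance

/- ### Separability of the sequence spaces -/

lemma lp_separable (𝕜 : Type) [RCLike 𝕜] (p : ℝ≥0∞) [Fact (1 ≤ p)] (hp : p ≠ ∞) :
    TopologicalSpace.SeparableSpace (lp (fun _ : ℤ => 𝕜) p) := by
  rw [← TopologicalSpace.isSeparable_univ_iff]
  have h1 : TopologicalSpace.IsSeparable
      (Set.range fun k : ℤ => (lp.single p k (1 : 𝕜) : lp (fun _ : ℤ => 𝕜) p)) :=
    (Set.countable_range _).isSeparable
  refine (h1.span (R := 𝕜)).closure.mono fun f _ => ?_
  refine mem_closure_of_tendsto (lp.hasSum_single hp f) (Eventually.of_forall fun s => ?_)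
  refine Submodule.sum_mem _ fun i _ => ?_
  have : (lp.single p i (f i) : lp (fun _ : ℤ => 𝕜) p) = f i • lp.single p i (1 : 𝕜) := by
    rw [← lp.single_smul]; simp
  rw [this]
  exact Submodule.smul_mem _ _ (Submodule.subset_span ⟨i, rfl⟩)

/-- The basis vector `a e_k` of `c₀(ℤ)`. -/
def c0single {𝕜 : Type} [RCLike 𝕜] (k : ℤ) (a : 𝕜) : ZeroAtInftyContinuousMap ℤ 𝕜 where
  toFun := Pi.single k a
  continuous_toFun := continuous_of_discreteTopology
  zero_at_infty' := by
    rw [Filter.cocompact_eq_cofinite]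
    refine tendsto_const_nhds.congr' ?_
    filter_upwards [(Set.finite_singleton k).compl_mem_cofinite] with n hn
    exact (Pi.single_eq_of_ne (M := fun _ : ℤ => 𝕜) hn a).symm

lemma c0single_apply {𝕜 : Type} [RCLike 𝕜] (k : ℤ) (a : 𝕜) (n : ℤ) :
    c0single k a n = if n = k then a else 0 := by
  change Pi.single (M := fun _ => 𝕜) k a n = _
  rw [Pi.single_apply]

lemma c0_norm_le {𝕜 : Type} [RCLike 𝕜] (f : ZeroAtInftyContinuousMap ℤ 𝕜) {C : ℝ} (hC : 0 ≤ C)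
    (h : ∀ n, ‖f n‖ ≤ C) : ‖f‖ ≤ C := by
  rw [← ZeroAtInftyContinuousMap.norm_toBCF_eq_norm]
  exact (BoundedContinuousFunction.norm_le hC).2 h

lemma c0_coord_le {𝕜 : Type} [RCLike 𝕜] (f : ZeroAtInftyContinuousMap ℤ 𝕜) (n : ℤ) :
    ‖f n‖ ≤ ‖f‖ := by
  rw [← ZeroAtInftyContinuousMap.norm_toBCF_eq_norm]
  exact f.toBCF.norm_coe_le_norm n

lemma c0_sum_apply {𝕜 : Type} [RCLike 𝕜] {ι : Type*} (s : Finset ι)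
    (f : ι → ZeroAtInftyContinuousMap ℤ 𝕜) (n : ℤ) : (∑ i ∈ s, f i) n = ∑ i ∈ s, f i n := by
  classical
  induction s using Finset.induction_on with
  | empty => simp
  | insert a s ha ih => simp [Finset.sum_insert ha, ih]

lemma c0_approx {𝕜 : Type} [RCLike 𝕜] (f : ZeroAtInftyContinuousMap ℤ 𝕜) {ε : ℝ} (hε : 0 < ε) :
    ∃ s : Finset ℤ, ‖f - ∑ i ∈ s, c0single i (f i)‖ ≤ ε := by
  have hz := f.zero_at_infty'
  rw [Filter.cocompact_eq_cofinite] at hz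
  have hz' : ∀ᶠ n in cofinite, ‖f n‖ < ε := by
    have := (tendsto_zero_iff_norm_tendsto_zero.1 hz)
    exact this.eventually_lt_const hε
  have hfin := Filter.eventually_cofinite.1 hz'
  refine ⟨hfin.toFinset, c0_norm_le _ hε.le fun n => ?_⟩
  rw [ZeroAtInftyContinuousMap.sub_apply, c0_sum_apply]
  simp only [c0single_apply, Finset.sum_ite_eq]
  split_ifs with hn
  · simpa using hε.le
  · simp only [Set.Finite.mem_toFinset, Set.mem_ofPred_eq, not_not] at hn
    simpa using hn.le

lemma c0_separable (𝕜 : Type) [RCLike 𝕜] :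
    TopologicalSpace.SeparableSpace (ZeroAtInftyContinuousMap ℤ 𝕜) := by
  rw [← TopologicalSpace.isSeparable_univ_iff]
  have h1 : TopologicalSpace.IsSeparable
      (Set.range fun k : ℤ => c0single k (1 : 𝕜)) :=
    (Set.countable_range _).isSeparable
  refine (h1.span (R := 𝕜)).closure.mono fun f _ => ?_
  rw [Metric.mem_closure_iff]
  intro ε hε
  obtain ⟨s, hs⟩ := c0_approx f (half_pos hε)
  refine ⟨∑ i ∈ s, c0single i (f i), Submodule.sum_mem _ fun i _ => ?_, ?_⟩
  · have : c0single i (f i) = f i • c0single i (1 : 𝕜) := by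
      ext n
      simp [c0single_apply]
    rw [this]
    exact Submodule.smul_mem _ _ (Submodule.subset_span ⟨i, rfl⟩)
  · rw [dist_eq_norm]
    linarith

lemma c0_infDim : ¬ FiniteDimensional ℝ (ZeroAtInftyContinuousMap ℤ ℝ) := by
  intro h
  have hli : LinearIndependent ℝ (fun k : ℤ => c0single k (1 : ℝ)) := by
    rw [linearIndependent_iff']
    intro s g hg i hi
    have := congrArg (fun f : ZeroAtInftyContinuousMap ℤ ℝ => f i) hg
    simp only [c0_sum_apply, ZeroAtInftyContinuousMap.smul_apply, c0single_apply,
      ZeroAtInftyContinuousMap.zero_apply] at this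
    simpa [hi] using this
  have := hli.finite
  exact not_finite ℤ

/- ### The weighted shift attached to a set `A` -/

/-- The integers not in `A`. -/
def coSet (A : Set ℕ) : Set ℤ := {m : ℤ | ∀ n ∈ A, (n : ℤ) ≠ m}

/-- Distance of `|m|` to the complement of `A` in `ℤ`. -/
noncomputable def depth (A : Set ℕ) (m : ℤ) : ℝ := Metric.infDist |m| (coSet A)

lemma coSet_nonempty (A : Set ℕ) : (coSet A).Nonempty := ⟨-1, fun n _ => by omega⟩

lemma depth_nonneg (A : Set ℕ) (m : ℤ) : 0 ≤ depth A m := Metric.infDist_nonneg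

lemma depth_neg (A : Set ℕ) (m : ℤ) : depth A (-m) = depth A m := by
  simp [depth]

lemma depth_lip (A : Set ℕ) (m k : ℤ) : depth A m ≤ depth A k + |(m : ℝ) - k| := by
  refine (Metric.infDist_le_infDist_add_dist (y := |k|)).trans ?_
  refine add_le_add le_rfl ?_
  rw [Int.dist_eq]
  push_cast
  exact abs_abs_sub_abs_le _ _

lemma depth_zero_of_notMem (A : Set ℕ) (n : ℕ) (hn : n ∉ A) : depth A n = 0 := by
  refine Metric.infDist_zero_of_mem ?_
  intro m hm h
  rw [Nat.abs_cast] at h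
  have : m = n := by exact_mod_cast h
  exact hn (this ▸ hm)

lemma le_depth (A : Set ℕ) (n L : ℕ) (h : ∀ i : ℤ, |i| ≤ (L : ℤ) → n ∈ shiftSet A i) :
    (L : ℝ) ≤ depth A n := by
  refine (Metric.le_infDist (coSet_nonempty A)).2 fun y hy => ?_
  rw [Nat.abs_cast, Int.dist_eq]
  by_contra hlt
  push Not at hlt
  have h1 : |(n : ℤ) - y| < L := by exact_mod_cast hlt
  obtain ⟨m, hm, hm'⟩ := h _ h1.le
  exact hy m hm (by omega)

/-- The `j`-th power of the weighted shift attached to `A`. -/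
noncomputable def powShift (A : Set ℕ) (j : ℤ) (x : ZeroAtInftyContinuousMap ℤ ℝ) :
    ZeroAtInftyContinuousMap ℤ ℝ where
  toFun m := Real.exp (depth A (m + j) - depth A m) * x (m + j)
  continuous_toFun := continuous_of_discreteTopology
  zero_at_infty' := by
    have hz := x.zero_at_infty'
    rw [Filter.cocompact_eq_cofinite] at hz ⊢
    have hz' : Tendsto (fun m : ℤ => x (m + j)) cofinite (𝓝 0) :=
      hz.comp (add_left_injective j).tendsto_cofinite
    have h0 : Tendsto (fun m : ℤ => Real.exp |(j : ℝ)| * ‖x (m + j)‖) cofinite (𝓝 0) := by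
      simpa using (tendsto_zero_iff_norm_tendsto_zero.1 hz').const_mul (Real.exp |(j : ℝ)|)
    refine squeeze_zero_norm (fun m => ?_) h0
    rw [norm_mul, Real.norm_eq_abs, Real.abs_exp]
    refine mul_le_mul_of_nonneg_right (Real.exp_le_exp.2 ?_) (norm_nonneg _)
    have := depth_lip A (m + j) m
    push_cast at this
    rw [add_sub_cancel_left] at this
    linarith

lemma powShift_apply (A : Set ℕ) (j : ℤ) (x : ZeroAtInftyContinuousMap ℤ ℝ) (m : ℤ) :
    powShift A j x m = Real.exp (depth A (m + j) - depth A m) * x (m + j) := rfl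

lemma depth_step (A : Set ℕ) (m : ℤ) :
    depth A (m + 1) - depth A m ≤ 1 ∧ -1 ≤ depth A (m + 1) - depth A m := by
  have h1 := depth_lip A (m + 1) m
  have h2 := depth_lip A m (m + 1)
  push_cast at h1 h2
  rw [add_sub_cancel_left, abs_one] at h1
  rw [sub_add_cancel_left, abs_neg, abs_one] at h2
  constructor <;> linarith

/-- The weighted shift attached to `A`. -/
noncomputable def wShift (A : Set ℕ) :
    ZeroAtInftyContinuousMap ℤ ℝ →L[ℝ] ZeroAtInftyContinuousMap ℤ ℝ :=
  LinearMap.mkContinuous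
    { toFun := powShift A 1
      map_add' := fun x y => by
        ext m
        simp only [powShift_apply, ZeroAtInftyContinuousMap.add_apply]
        ring
      map_smul' := fun c x => by
        ext m
        simp only [powShift_apply, ZeroAtInftyContinuousMap.smul_apply, smul_eq_mul,
          RingHom.id_apply]
        ring } (Real.exp 1) (fun x => by
      refine c0_norm_le _ (by positivity) fun m => ?_
      change ‖powShift A 1 x m‖ ≤ _
      rw [powShift_apply, norm_mul, Real.norm_eq_abs, Real.abs_exp]
      exact mul_le_mul (Real.exp_le_exp.2 (depth_step A m).1) (c0_coord_le _ _) (norm_nonneg _)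
        (Real.exp_pos _).le)

lemma wShift_apply (A : Set ℕ) (x : ZeroAtInftyContinuousMap ℤ ℝ) :
    wShift A x = powShift A 1 x := rfl

lemma wShift_iterate (A : Set ℕ) (n : ℕ) (x : ZeroAtInftyContinuousMap ℤ ℝ) :
    (wShift A)^[n] x = powShift A n x := by
  induction n with
  | zero => ext m; simp [powShift_apply]
  | succ n ih =>
    rw [Function.iterate_succ_apply', ih, wShift_apply]
    ext m
    simp only [powShift_apply]
    rw [← mul_assoc, ← Real.exp_add]
    have : m + 1 + (n : ℤ) = m + ((n + 1 : ℕ) : ℤ) := by push_cast; ring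
    rw [this]
    congr 2
    ring

lemma wShift_isInvertible (A : Set ℕ) :
    IsInvertibleWBSc0 ℝ (fun n => Real.exp (depth A n - depth A (n - 1))) (wShift A) := by
  refine ⟨fun n => Real.exp_pos _, ⟨Real.exp 1, fun n => ?_⟩, ⟨Real.exp (-1), Real.exp_pos _,
    fun n => ?_⟩, fun x n => ?_⟩
  · have := (depth_step A (n - 1)).1
    rw [sub_add_cancel] at this
    exact Real.exp_le_exp.2 this
  · have := (depth_step A (n - 1)).2
    rw [sub_add_cancel] at this
    exact Real.exp_le_exp.2 this
  · simp only [wShift_apply, powShift_apply, add_sub_cancel_right, smul_eq_mul]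

lemma powShift_norm_le (A : Set ℕ) (j : ℤ) (K : ℕ) (L : ℝ) (u : ZeroAtInftyContinuousMap ℤ ℝ)
    (hu : ∀ n : ℤ, (K : ℤ) < |n| → u n = 0) (hj : L ≤ depth A j) :
    ‖powShift A j u‖ ≤ Real.exp (depth A 0 + 2 * K - L) * ‖u‖ := by
  refine c0_norm_le _ (by positivity) fun m => ?_
  rw [powShift_apply]
  by_cases hm : (K : ℤ) < |m + j|
  · rw [hu _ hm, mul_zero, norm_zero]
    positivity
  · rw [norm_mul, Real.norm_eq_abs, Real.abs_exp]
    refine mul_le_mul (Real.exp_le_exp.2 ?_) (c0_coord_le _ _) (norm_nonneg _)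
        (Real.exp_pos _).le
    have hm' : |(m : ℝ) + j| ≤ K := by
      have := not_lt.1 hm
      exact_mod_cast this
    have h1 := depth_lip A (m + j) 0
    have h2 := depth_lip A (-j) m
    rw [depth_neg] at h2
    push_cast at h1 h2
    rw [sub_zero] at h1
    have h3 : |-(j : ℝ) - m| = |(m : ℝ) + j| := by rw [← abs_neg]; congr 1; ring
    rw [h3] at h2
    linarith

lemma exists_finSupp {U : Set (ZeroAtInftyContinuousMap ℤ ℝ)} (hU : IsOpen U) (nU : U.Nonempty) :
    ∃ u ∈ U, ∃ K : ℕ, ∀ n : ℤ, (K : ℤ) < |n| → u n = 0 := by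
  obtain ⟨x, hx⟩ := nU
  obtain ⟨ε, hε, hb⟩ := Metric.isOpen_iff.1 hU x hx
  obtain ⟨s, hs⟩ := c0_approx x (half_pos hε)
  refine ⟨∑ i ∈ s, c0single i (x i), hb ?_, ∑ i ∈ s, i.natAbs, fun n hn => ?_⟩
  · rw [Metric.mem_ball, dist_comm, dist_eq_norm]
    linarith
  · rw [c0_sum_apply]
    refine Finset.sum_eq_zero fun i hi => ?_
    rw [c0single_apply, if_neg]
    rintro rfl
    have := Finset.single_le_sum (f := fun i : ℤ => i.natAbs) (fun _ _ => Nat.zero_le _) hi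
    rw [Int.abs_eq_natAbs] at hn
    omega

lemma wShift_nset (A : Set ℕ) {U V : Set (ZeroAtInftyContinuousMap ℤ ℝ)} (hU : IsOpen U)
    (hV : IsOpen V) (nU : U.Nonempty) (nV : V.Nonempty) :
    ∃ L : ℕ, ∀ n : ℕ, (L : ℝ) ≤ depth A n → n ∈ nset (wShift A) U V := by
  obtain ⟨u, hu, K, hK⟩ := exists_finSupp hU nU
  obtain ⟨v, hv, K', hK'⟩ := exists_finSupp hV nV
  obtain ⟨ε, hε, hb⟩ := Metric.isOpen_iff.1 hU u hu
  obtain ⟨ε', hε', hb'⟩ := Metric.isOpen_iff.1 hV v hv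
  have lim : ∀ c d : ℝ, Tendsto (fun L : ℕ => Real.exp (c - L) * d) atTop (𝓝 0) := by
    intro c d
    have h1 : Tendsto (fun L : ℕ => c - (L : ℝ)) atTop atBot :=
      tendsto_atBot_add_const_left _ c (tendsto_neg_atTop_atBot.comp tendsto_natCast_atTop_atTop)
    simpa using (Real.tendsto_exp_atBot.comp h1).mul_const d
  obtain ⟨L, hL, hL'⟩ := (((lim (depth A 0 + 2 * K) ‖u‖).eventually_lt_const hε').and
    ((lim (depth A 0 + 2 * K') ‖v‖).eventually_lt_const hε)).exists
  refine ⟨L, fun n hn => ⟨u + powShift A (-n) v, hb ?_, hb' ?_⟩⟩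
  · rw [Metric.mem_ball, dist_eq_norm, add_sub_cancel_left]
    exact (powShift_norm_le A _ K' L v hK' (by rwa [depth_neg])).trans_lt hL'
  · have : (wShift A)^[n] (u + powShift A (-n) v) = powShift A n u + v := by
      rw [wShift_iterate]
      ext m
      simp only [powShift_apply, ZeroAtInftyContinuousMap.add_apply]
      rw [add_neg_cancel_right, mul_add, ← mul_assoc, ← Real.exp_add]
      simp
    rw [this, Metric.mem_ball, dist_eq_norm, add_sub_cancel_right]
    exact (powShift_norm_le A _ K L u hK hn).trans_lt hL

lemma wShift_fMix {F : Set (Set ℕ)} (hF : IsFamily F) {A : Set ℕ} (hA : A ∈ tildeFam F) :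
    FMix (wShift A) F := by
  intro U V hU hV nU nV
  obtain ⟨U₁, U₂, hU₁, hU₂, nU₁, nU₂, hs⟩ := exists_box hU nU
  obtain ⟨V₁, V₂, hV₁, hV₂, nV₁, nV₂, hs'⟩ := exists_box hV nV
  obtain ⟨L₁, h₁⟩ := wShift_nset A hU₁ hV₁ nU₁ nV₁
  obtain ⟨L₂, h₂⟩ := wShift_nset A hU₂ hV₂ nU₂ nV₂
  refine hF.2.1 (hA.2 (max L₁ L₂)) fun n hn => nset_mono _ hs hs' ?_
  rw [nset_prod]
  have := le_depth A n _ hn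
  push_cast at this
  exact ⟨h₁ n ((le_max_left _ _).trans this), h₂ n ((le_max_right _ _).trans this)⟩

lemma wShift_nset_subset (A : Set ℕ) :
    ∃ U V : Set (ZeroAtInftyContinuousMap ℤ ℝ), IsOpen U ∧ IsOpen V ∧ U.Nonempty ∧ V.Nonempty ∧
      nset (wShift A) U V ⊆ A := by
  have hc : Continuous fun y : ZeroAtInftyContinuousMap ℤ ℝ => ‖y 0‖ := by
    refine continuous_norm.comp ?_
    have : LipschitzWith 1 fun y : ZeroAtInftyContinuousMap ℤ ℝ => y 0 := by
      refine LipschitzWith.of_dist_le_mul fun x y => ?_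
      rw [dist_eq_norm, dist_eq_norm, ← ZeroAtInftyContinuousMap.sub_apply, NNReal.coe_one,
        one_mul]
      exact c0_coord_le _ _
    exact this.continuous
  refine ⟨Metric.ball 0 1, {y | 1 < ‖y 0‖}, Metric.isOpen_ball,
    isOpen_lt continuous_const hc, ⟨0, by simp⟩, ⟨c0single 0 2, ?_⟩, ?_⟩
  · change 1 < ‖c0single 0 (2 : ℝ) 0‖
    rw [c0single_apply, if_pos rfl]
    norm_num
  · rintro n ⟨x, hx, hx'⟩
    by_contra hn
    have h1 : 1 < ‖(wShift A)^[n] x 0‖ := hx'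
    rw [wShift_iterate, powShift_apply, norm_mul, Real.norm_eq_abs, Real.abs_exp, zero_add,
      depth_zero_of_notMem A n hn] at h1
    have h2 : Real.exp (0 - depth A 0) ≤ 1 := Real.exp_le_one_iff.2 (by
      have := depth_nonneg A 0
      linarith)
    have h3 : ‖x n‖ < 1 := (c0_coord_le x n).trans_lt (by simpa using hx)
    have := mul_le_mul_of_nonneg_right h2 (norm_nonneg (x n))
    linarith

lemma fTrans_of_disjoint_wShift {F : Set (Set ℕ)} {X : Type*} [TopologicalSpace X] [T1Space X]
    {T : X → X}
    (h : ∀ A ∈ tildeFam F, WeaklyDisjoint T (wShift A)) : FTrans T (dualFam (tildeFam F)) := by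
  intro U V hU hV nU nV A hA
  obtain ⟨U', V', hU', hV', nU', nV', hs⟩ := wShift_nset_subset A
  have : Nontrivial (ZeroAtInftyContinuousMap ℤ ℝ) := by
    by_contra hne
    rw [not_nontrivial_iff_subsingleton] at hne
    exact c0_infDim inferInstance
  have hne : ∀ x : X × ZeroAtInftyContinuousMap ℤ ℝ, NeBot (𝓝[≠] x) := by
    rintro ⟨x, y⟩
    have hy : NeBot (𝓝[≠] y) := Module.punctured_nhds_neBot ℝ _ y
    have ht : Tendsto (fun z => (x, z)) (𝓝[≠] y) (𝓝[≠] (x, y)) := by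
      refine tendsto_nhdsWithin_of_tendsto_nhds_of_eventually_within _ ?_ ?_
      · exact ((Continuous.prodMk_right x).tendsto y).mono_left nhdsWithin_le_nhds
      · filter_upwards [self_mem_nhdsWithin] with z hz hzz
        exact hz (congrArg Prod.snd hzz)
    exact ht.neBot
  have ht := topTrans_of_hypercyclic (h A hA) (U ×ˢ U') (V ×ˢ V') (hU.prod hU') (hV.prod hV')
    (nU.prod nU') (nV.prod nV')
  rw [nset_prod] at ht
  exact ht.mono (inter_subset_inter_right _ hs)

/-- The weighted shift attached to `A` as a bundled operator. -/
noncomputable def wShiftOp (A : Set ℕ) : FrechetOp :=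
  haveI := c0_separable ℝ
  { 𝕜 := ℝ
    X := ZeroAtInftyContinuousMap ℤ ℝ
    infDim := c0_infDim
    T := wShift A
    linear := (wShift A).toLinearMap.isLinear
    cont := (wShift A).continuous }

/-- **Weiss–Akin–Glasner Theorem for operators.** Let `F` be a full
Furstenberg family and `T` an operator. The following are equivalent: (1) `T` is
`(F̃)*`-transitive; (2) `T` is weakly disjoint from every `F`-mixing operator;
(3) `T` is weakly disjoint from every invertible `F`-mixing bilateral weighted backward
shift on `c₀(ℤ)` or `ℓᵖ(ℤ)`, `1 ≤ p < ∞`. -/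
theorem tildeFamStar_transitive_iff_weaklyDisjoint_from_fMixing
    (F : Set (Set ℕ)) (hF : IsFamily F) (hfull : FullFamily F) (T : FrechetOp) :
    (FTrans T.T (dualFam (tildeFam F)) ↔
      ∀ S : FrechetOp, FMix S.T F → WeaklyDisjoint T.T S.T) ∧
    (FTrans T.T (dualFam (tildeFam F)) ↔
      ∀ (𝕜 : Type) [RCLike 𝕜],
        (∀ (p : ℝ≥0∞) [Fact (1 ≤ p)], p ≠ ∞ →
          ∀ (w : ℤ → ℝ) (B : lp (fun _ : ℤ => 𝕜) p →L[𝕜] lp (fun _ : ℤ => 𝕜) p),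
            IsInvertibleWBSlp 𝕜 p w B → FMix ⇑B F → WeaklyDisjoint T.T ⇑B) ∧
        (∀ (w : ℤ → ℝ) (B : ZeroAtInftyContinuousMap ℤ 𝕜 →L[𝕜] ZeroAtInftyContinuousMap ℤ 𝕜),
            IsInvertibleWBSc0 𝕜 w B → FMix ⇑B F → WeaklyDisjoint T.T ⇑B)) := by
  have hpT := T.polish
  have hT1 : T1Space T.X := inferInstance
  refine ⟨⟨fun h S hS => ?_, fun h => fTrans_of_disjoint_wShift fun A hA =>
    h (wShiftOp A) (wShift_fMix hF hA)⟩, ⟨fun h 𝕜 _ => ⟨?_, ?_⟩, fun h =>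
      fTrans_of_disjoint_wShift fun A hA => (h ℝ).2 _ (wShift A) (wShift_isInvertible A)
        (wShift_fMix hF hA)⟩⟩
  · have := S.polish
    exact weaklyDisjoint_of_fTrans T.cont S.cont hF hfull h hS
  · intro p _ hp w B _ hB
    have := lp_separable 𝕜 p hp
    exact weaklyDisjoint_of_fTrans T.cont B.continuous hF hfull h hB
  · intro w B _ hB
    have := c0_separable 𝕜
    exact weaklyDisjoint_of_fTrans T.cont B.continuous hF hfull h hB
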